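/- Every right inverse for the output-feedback group law is also a left inverse: if c, c^{-1} ∈ ℝ^m⟨⟨X⟩⟩ satisfy c^{-1} = (−c) ∘̃ c^{-1}, then c = (−c^{-1}) ∘̃ c. -/

import Mathlib

/-!
STATEMENT 0: The set ℝ^m⟨⟨X_δ⟩⟩ forms a group under the composition product;
equivalently, c ⊚ d := d + c ∘̃ d on ℝ^m⟨⟨X⟩⟩ is associative, has 0 as a two-sided
identity, and every c has a two-sided inverse.
-/

open scoped BigOperators

namespace FliessStmt

/-- Words over the alphabet `X = {x_0, …, x_m}`. -/
abbrev Word (m : ℕ) := List (Fin (m + 1))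

/-- Formal power series over `X`: coefficient functions on words. -/
abbrev Series (m : ℕ) := Word m → ℝ

noncomputable section

variable (m : ℕ)

/-- The series `1 = 1∅`. -/
def one : Series m := fun ν => if ν = [] then 1 else 0

/-- Left catenation by the letter `x_i`:  `e ↦ x_i e`. -/
def cat (i : Fin (m + 1)) (e : Series m) : Series m := fun ν =>
  match ν with
  | [] => 0
  | j :: ν' => if j = i then e ν' else 0

/-- The shuffle product of two words, as a formal power series (a polynomial):
`(x_i η) ⧢ (x_j ξ) = x_i(η ⧢ (x_j ξ)) + x_j((x_i η) ⧢ ξ)`, `∅ ⧢ η = η ⧢ ∅ = η`. -/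
def shw : Word m → Word m → Series m
  | [], ξ => fun ν => if ν = ξ then 1 else 0
  | η, [] => fun ν => if ν = η then 1 else 0
  | i :: η, j :: ξ => cat m i (shw η (j :: ξ)) + cat m j (shw (i :: η) ξ)
  termination_by η ξ => η.length + ξ.length

/-- The shuffle product, extended bilinearly to formal power series. -/
def sh (c d : Series m) : Series m := fun ν =>
  ∑ᶠ p : Word m × Word m, c p.1 * d p.2 * shw m p.1 p.2 ν

/-- For `d ∈ ℝ^m⟨⟨X⟩⟩`, the component `d_i` with the convention `d_0 := 0`. -/
def dsel (d : Fin m → Series m) (i : Fin (m + 1)) : Series m :=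
  if h : i = 0 then 0 else d (i.pred h)

/-- `φ_d(x_i)(e) = x_i e + x_0 (d_i ⧢ e)`. -/
def phiStep (d : Fin m → Series m) (i : Fin (m + 1)) (e : Series m) : Series m :=
  cat m i e + cat m 0 (sh m (dsel m d i) e)

/-- The homomorphism `φ_d` on words, `φ_d(∅) = id`, `φ_d(x_i η) = φ_d(x_i) ∘ φ_d(η)`. -/
def phi (d : Fin m → Series m) : Word m → Series m → Series m
  | [], e => e
  | i :: η, e => phiStep m d i (phi d η e)

/-- The modified composition product `c ∘̃ d = Σ_η (c,η) φ_d(η)(1)`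
(the sum is locally finite, hence given coefficientwise by a finite sum). -/
def modcomp (c : Series m) (d : Fin m → Series m) : Series m := fun ν =>
  ∑ᶠ η : Word m, c η * phi m d η (one m) ν

/-- The modified composition product, componentwise for vector-valued `c`. -/
def modcompV {ℓ : ℕ} (c : Fin ℓ → Series m) (d : Fin m → Series m) : Fin ℓ → Series m :=
  fun j => modcomp m (c j) d

/-- The group product `c ⊚ d := d + c ∘̃ d` on `ℝ^m⟨⟨X⟩⟩`
(so that `c_δ ∘ d_δ = δ + c ⊚ d`). -/
def gprod (c d : Fin m → Series m) : Fin m → Series m :=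
  d + modcompV m c d

variable {m}

/-- The left shift `x_i⁻¹ e`, whose coefficient at `ν` is that of `e` at `x_i ν`. -/
def leftShift (i : Fin (m + 1)) (e : Series m) : Series m := fun ν => e (i :: ν)

/-- The finset of words of length at most `n`. -/
def wordsUpTo (m : ℕ) : ℕ → Finset (Word m)
  | 0 => {[]}
  | n + 1 => insert [] ((Finset.univ ×ˢ wordsUpTo m n).image fun p => p.1 :: p.2)

theorem mem_wordsUpTo {n : ℕ} {η : Word m} : η ∈ wordsUpTo m n ↔ η.length ≤ n := by
  induction n generalizing η with
  | zero => simp [wordsUpTo]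
  | succ n ih => cases η <;> simp [wordsUpTo, ih]

theorem sum_wordsUpTo_succ (n : ℕ) (f : Word m → ℝ) :
    ∑ η ∈ wordsUpTo m (n + 1), f η = f [] + ∑ i, ∑ η ∈ wordsUpTo m n, f (i :: η) := by
  rw [wordsUpTo, Finset.sum_insert (by simp), Finset.sum_image, Finset.sum_product]
  rintro ⟨i, η⟩ _ ⟨j, ξ⟩ _ h
  simpa using h

/-! ### The shuffle product -/

theorem shw_nil_right (η : Word m) : shw m η [] = fun ν => if ν = η then 1 else 0 := by
  cases η <;> simp [shw]

theorem shw_apply_nil (η ξ : Word m) :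
    shw m η ξ [] = if η = [] ∧ ξ = [] then 1 else 0 := by
  cases η <;> cases ξ <;> simp [shw, cat]

theorem shw_apply_cons (η ξ : Word m) (k : Fin (m + 1)) (ν : Word m) :
    shw m η ξ (k :: ν) =
      (if η.head? = some k then shw m η.tail ξ ν else 0) +
        (if ξ.head? = some k then shw m η ξ.tail ν else 0) := by
  rcases η with _ | ⟨i, η⟩ <;> rcases ξ with _ | ⟨j, ξ⟩
  · simp [shw]
  · by_cases h : j = k
    · simp [shw, h]
    · simp [shw, h, Ne.symm h]
  · by_cases h : i = k
    · simp [shw_nil_right, h]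
    · simp [shw, h, Ne.symm h]
  · simp [shw, cat, eq_comm]

theorem shw_eq_zero_of_length_ne (η ξ ν : Word m) (h : η.length + ξ.length ≠ ν.length) :
    shw m η ξ ν = 0 := by
  induction ν generalizing η ξ with
  | nil =>
    rw [shw_apply_nil, if_neg]
    rintro ⟨rfl, rfl⟩
    simp at h
  | cons k ν ih =>
    rw [shw_apply_cons]
    rcases η with _ | ⟨i, η⟩ <;> rcases ξ with _ | ⟨j, ξ⟩ <;>
      simp only [List.length_cons, List.length_nil] at h <;>
      simp only [List.head?_nil, List.head?_cons, List.tail_cons, reduceCtorEq, if_false]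
    · simp
    · rw [ih _ _ (by simp; omega)]; simp
    · rw [ih _ _ (by simp; omega)]; simp
    · rw [ih _ _ (by simp; omega), ih _ _ (by simp; omega)]; simp

theorem sh_eq_sum (a b : Series m) {ν : Word m} {p q : ℕ} (hp : ν.length ≤ p)
    (hq : ν.length ≤ q) :
    sh m a b ν = ∑ η ∈ wordsUpTo m p, ∑ ξ ∈ wordsUpTo m q, a η * b ξ * shw m η ξ ν := by
  rw [sh, finsum_eq_sum_of_support_subset (s := wordsUpTo m p ×ˢ wordsUpTo m q),
    Finset.sum_product]
  rintro ⟨η, ξ⟩ h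
  have hl : η.length + ξ.length = ν.length := by
    by_contra hne
    exact h (by simp [shw_eq_zero_of_length_ne _ _ _ hne])
  simp only [Finset.coe_product, Set.mem_prod, Finset.mem_coe, mem_wordsUpTo]
  omega

theorem sh_apply_nil (a b : Series m) : sh m a b [] = a [] * b [] := by
  rw [sh_eq_sum a b (p := 0) (q := 0) (by simp) (by simp)]
  simp [wordsUpTo, shw_apply_nil]

theorem sh_apply_cons (a b : Series m) (k : Fin (m + 1)) (ν : Word m) :
    sh m a b (k :: ν) = sh m (leftShift k a) b ν + sh m a (leftShift k b) ν := by
  rw [sh_eq_sum a b (p := ν.length + 1) (q := ν.length + 1) (by simp) (by simp),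
    sh_eq_sum (leftShift k a) b (p := ν.length) (q := ν.length + 1) le_rfl (by simp),
    sh_eq_sum a (leftShift k b) (p := ν.length + 1) (q := ν.length) (by simp) le_rfl]
  simp only [shw_apply_cons, mul_add, Finset.sum_add_distrib]
  congr 1
  · rw [sum_wordsUpTo_succ]
    simp only [List.head?_nil, List.head?_cons, List.tail_cons, reduceCtorEq, if_false,
      mul_zero, Finset.sum_const_zero, zero_add, Option.some.injEq]
    rw [Finset.sum_eq_single k (fun i _ hi => by simp [hi]) (by simp)]
    simp [leftShift]
  · refine Finset.sum_congr rfl fun η _ => ?_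
    rw [sum_wordsUpTo_succ]
    simp only [List.head?_nil, List.head?_cons, List.tail_cons, reduceCtorEq, if_false,
      mul_zero, zero_add, Option.some.injEq]
    rw [Finset.sum_eq_single k (fun i _ hi => by simp [hi]) (by simp)]
    simp [leftShift]

theorem leftShift_sh (k : Fin (m + 1)) (a b : Series m) :
    leftShift k (sh m a b) = sh m (leftShift k a) b + sh m a (leftShift k b) :=
  funext fun ν => sh_apply_cons a b k ν

theorem sh_comm (a b : Series m) : sh m a b = sh m b a := by
  funext ν
  induction ν generalizing a b with
  | nil => simp only [sh_apply_nil, mul_comm]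
  | cons k ν ih => rw [sh_apply_cons, sh_apply_cons, ih, ih a, add_comm]

theorem sh_add (a b c : Series m) : sh m a (b + c) = sh m a b + sh m a c := by
  funext ν
  induction ν generalizing a b c with
  | nil => simp only [Pi.add_apply, sh_apply_nil, mul_add]
  | cons k ν ih =>
    have hs : leftShift k (b + c) = leftShift k b + leftShift k c := rfl
    simp only [Pi.add_apply, sh_apply_cons, hs, ih]
    ring

theorem add_sh (a b c : Series m) : sh m (a + b) c = sh m a c + sh m b c := by
  rw [sh_comm, sh_add, sh_comm c a, sh_comm c b]

theorem sh_smul (a : Series m) (r : ℝ) (b : Series m) : sh m a (r • b) = r • sh m a b := by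
  funext ν
  induction ν generalizing a b with
  | nil => simp only [Pi.smul_apply, smul_eq_mul, sh_apply_nil]; ring
  | cons k ν ih =>
    have hs : leftShift k (r • b) = r • leftShift k b := rfl
    simp only [Pi.smul_apply, sh_apply_cons, hs, ih, smul_add]

/-- Left shuffle multiplication as a linear map. -/
def shLinear (a : Series m) : Series m →ₗ[ℝ] Series m where
  toFun := sh m a
  map_add' := sh_add a
  map_smul' := sh_smul a

theorem sh_zero (a : Series m) : sh m a 0 = 0 := (shLinear a).map_zero

theorem zero_sh (a : Series m) : sh m 0 a = 0 := by rw [sh_comm, sh_zero]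

theorem sh_sum {ι : Type*} (s : Finset ι) (a : Series m) (f : ι → Series m) :
    sh m a (∑ i ∈ s, f i) = ∑ i ∈ s, sh m a (f i) := map_sum (shLinear a) f s

theorem sh_assoc (a b c : Series m) : sh m (sh m a b) c = sh m a (sh m b c) := by
  funext ν
  induction ν generalizing a b c with
  | nil => simp only [sh_apply_nil, mul_assoc]
  | cons k ν ih =>
    simp only [sh_apply_cons, leftShift_sh, add_sh, sh_add, Pi.add_apply, ih]
    ring

theorem sh_left_comm (a b c : Series m) : sh m a (sh m b c) = sh m b (sh m a c) := by
  rw [← sh_assoc, sh_comm a b, sh_assoc]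

/-- A coefficient of `a ⧢ b` only involves the coefficients of `b` at words that are no longer. -/
theorem sh_congr_right (a : Series m) {b b' : Series m} {ν : Word m}
    (h : ∀ ξ : Word m, ξ.length ≤ ν.length → b ξ = b' ξ) : sh m a b ν = sh m a b' ν := by
  induction ν generalizing a b b' with
  | nil => rw [sh_apply_nil, sh_apply_nil, h [] le_rfl]
  | cons k ν ih =>
    rw [sh_apply_cons, sh_apply_cons, ih _ fun ξ hξ => h ξ (hξ.trans (by simp)),
      ih a (b := leftShift k b) (b' := leftShift k b')
        fun ξ hξ => h (k :: ξ) (by simpa using hξ)]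

/-! ### The modified composition product -/

theorem phi_one_eq_zero_of_length_lt (d : Fin m → Series m) {η ν : Word m}
    (h : ν.length < η.length) : phi m d η (one m) ν = 0 := by
  induction η generalizing ν with
  | nil => simp at h
  | cons i η ih =>
    rcases ν with _ | ⟨k, ν⟩
    · simp [phi, phiStep, cat]
    · have hlt : ν.length < η.length := by simpa using h
      have hsh : sh m (dsel m d i) (phi m d η (one m)) ν = 0 := by
        rw [sh_congr_right _ (b' := 0) fun ξ hξ => ih (hξ.trans_lt hlt), sh_zero]
        rfl
      simp [phi, phiStep, cat, ih hlt, hsh]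

theorem modcomp_eq_sum (c : Series m) (d : Fin m → Series m) {ν : Word m} {n : ℕ}
    (hn : ν.length ≤ n) :
    modcomp m c d ν = ∑ η ∈ wordsUpTo m n, c η * phi m d η (one m) ν := by
  refine finsum_eq_sum_of_support_subset _ fun η hη => ?_
  rw [Finset.mem_coe, mem_wordsUpTo]
  by_contra hlt
  exact hη (by simp [phi_one_eq_zero_of_length_lt d (show ν.length < η.length by omega)])

theorem modcomp_apply_nil (c : Series m) (d : Fin m → Series m) : modcomp m c d [] = c [] := by
  rw [modcomp_eq_sum c d (n := 0) (by simp)]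
  simp [wordsUpTo, phi, one]

theorem leftShift_modcomp (k : Fin (m + 1)) (c : Series m) (d : Fin m → Series m) :
    leftShift k (modcomp m c d) = modcomp m (leftShift k c) d +
      if k = 0 then ∑ i, sh m (dsel m d i) (modcomp m (leftShift i c) d) else 0 := by
  funext ν
  have hsh (i : Fin (m + 1)) : sh m (dsel m d i) (modcomp m (leftShift i c) d) ν =
      ∑ η ∈ wordsUpTo m ν.length,
        c (i :: η) * sh m (dsel m d i) (phi m d η (one m)) ν := by
    rw [sh_congr_right (b' := ∑ η ∈ wordsUpTo m ν.length, c (i :: η) • phi m d η (one m)),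
      sh_sum]
    · simp [sh_smul]
    · intro ξ hξ
      simp [modcomp_eq_sum _ d hξ, leftShift]
  have hphi (i : Fin (m + 1)) (η : Word m) : phi m d (i :: η) (one m) (k :: ν) =
      (if k = i then phi m d η (one m) ν else 0) +
        if k = 0 then sh m (dsel m d i) (phi m d η (one m)) ν else 0 := rfl
  rw [leftShift, modcomp_eq_sum c d (n := ν.length + 1) (by simp), sum_wordsUpTo_succ,
    Pi.add_apply, modcomp_eq_sum (leftShift k c) d le_rfl]
  simp only [hphi, mul_add, Finset.sum_add_distrib]
  rw [Finset.sum_eq_single k (fun i _ hi => by simp [hi.symm]) (by simp)]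
  by_cases hk : k = 0
  · simp [hk, hsh, phi, one, leftShift]
  · simp [hk, phi, one, leftShift]

theorem modcomp_add (a b : Series m) (d : Fin m → Series m) :
    modcomp m (a + b) d = modcomp m a d + modcomp m b d := by
  funext ν
  simp only [Pi.add_apply, modcomp_eq_sum _ d (le_refl ν.length), add_mul,
    Finset.sum_add_distrib]

/-- `c ↦ c ∘̃ d` as an additive homomorphism. -/
def modcompHom (d : Fin m → Series m) : Series m →+ Series m :=
  AddMonoidHom.mk' (fun c => modcomp m c d) fun a b => modcomp_add a b d

theorem modcomp_neg (a : Series m) (d : Fin m → Series m) :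
    modcomp m (-a) d = -modcomp m a d := map_neg (modcompHom d) a

theorem zero_modcomp (d : Fin m → Series m) : modcomp m 0 d = 0 := map_zero (modcompHom d)

theorem modcomp_sum {ι : Type*} (s : Finset ι) (f : ι → Series m) (d : Fin m → Series m) :
    modcomp m (∑ i ∈ s, f i) d = ∑ i ∈ s, modcomp m (f i) d := map_sum (modcompHom d) f s

theorem dsel_add (d e : Fin m → Series m) (i : Fin (m + 1)) :
    dsel m (d + e) i = dsel m d i + dsel m e i := by
  unfold dsel
  split_ifs <;> simp

theorem dsel_modcompV (d e : Fin m → Series m) (i : Fin (m + 1)) :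
    dsel m (modcompV m d e) i = modcomp m (dsel m d i) e := by
  unfold dsel
  split_ifs
  · rw [zero_modcomp]
  · rfl

theorem modcomp_zero (c : Series m) : modcomp m c 0 = c := by
  have hd (i : Fin (m + 1)) : dsel m (0 : Fin m → Series m) i = 0 := by
    unfold dsel
    split_ifs <;> rfl
  funext ν
  induction ν generalizing c with
  | nil => exact modcomp_apply_nil c 0
  | cons k ν ih =>
    have h := congrFun (leftShift_modcomp k c 0) ν
    simp only [hd, zero_sh, Finset.sum_const_zero, ite_self, add_zero, ih] at h
    exact h

/-- `c ↦ c ∘̃ e` is a homomorphism for the shuffle product. -/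
theorem modcomp_sh (a b : Series m) (e : Fin m → Series m) :
    modcomp m (sh m a b) e = sh m (modcomp m a e) (modcomp m b e) := by
  suffices H : ∀ (n : ℕ) (a b : Series m) (ν : Word m), ν.length ≤ n →
      modcomp m (sh m a b) e ν = sh m (modcomp m a e) (modcomp m b e) ν from
    funext fun ν => H _ a b ν le_rfl
  intro n
  induction n with
  | zero =>
    intro a b ν hν
    obtain rfl : ν = [] := by simpa using hν
    simp only [modcomp_apply_nil, sh_apply_nil]
  | succ n ih =>
    rintro a b (_ | ⟨k, ν⟩) hν
    · simp only [modcomp_apply_nil, sh_apply_nil]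
    have hν' : ν.length ≤ n := by simpa using hν
    have hsh (f a b : Series m) : sh m f (modcomp m (sh m a b) e) ν =
        sh m f (sh m (modcomp m a e) (modcomp m b e)) ν :=
      sh_congr_right f fun ξ hξ => ih a b ξ (hξ.trans hν')
    change leftShift k (modcomp m (sh m a b) e) ν =
      leftShift k (sh m (modcomp m a e) (modcomp m b e)) ν
    rw [leftShift_modcomp, leftShift_sh, leftShift_sh, leftShift_modcomp, leftShift_modcomp]
    by_cases hk : k = 0
    · simp only [hk, if_true, leftShift_sh, modcomp_add, sh_add, add_sh, Pi.add_apply,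
        Finset.sum_add_distrib, Finset.sum_apply, hsh, ih _ _ _ hν', sh_sum,
        sh_comm (∑ i, _) (modcomp m b e)]
      simp only [sh_left_comm (modcomp m b e), sh_comm (modcomp m b e),
        sh_left_comm (modcomp m a e)]
      ring
    · simp [hk, modcomp_add, ih _ _ _ hν']

theorem modcomp_modcomp (c : Series m) (d e : Fin m → Series m) :
    modcomp m (modcomp m c d) e = modcomp m c (modcompV m d e + e) := by
  suffices H : ∀ (n : ℕ) (c : Series m) (ν : Word m), ν.length ≤ n →
      modcomp m (modcomp m c d) e ν = modcomp m c (modcompV m d e + e) ν from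
    funext fun ν => H _ c ν le_rfl
  intro n
  induction n with
  | zero =>
    intro c ν hν
    obtain rfl : ν = [] := by simpa using hν
    simp only [modcomp_apply_nil]
  | succ n ih =>
    rintro c (_ | ⟨k, ν⟩) hν
    · simp only [modcomp_apply_nil]
    have hν' : ν.length ≤ n := by simpa using hν
    have hsh (f c : Series m) : sh m f (modcomp m c (modcompV m d e + e)) ν =
        sh m f (modcomp m (modcomp m c d) e) ν :=
      sh_congr_right f fun ξ hξ => (ih c ξ (hξ.trans hν')).symm
    have hsel (i : Fin (m + 1)) :
        sh m (dsel m e i) (modcomp m (leftShift i (modcomp m c d)) e) =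
          sh m (dsel m e i) (modcomp m (modcomp m (leftShift i c) d) e) := by
      by_cases hi : i = 0
      · simp [dsel, hi, zero_sh]
      · simp [leftShift_modcomp, hi]
    change leftShift k (modcomp m (modcomp m c d) e) ν =
      leftShift k (modcomp m c (modcompV m d e + e)) ν
    rw [leftShift_modcomp, leftShift_modcomp k c (modcompV m d e + e)]
    simp only [hsel]
    rw [leftShift_modcomp]
    by_cases hk : k = 0
    · simp only [hk, if_true, modcomp_add, modcomp_sum, modcomp_sh, Pi.add_apply,
        Finset.sum_apply, ih _ _ hν', dsel_add, dsel_modcompV, add_sh, hsh,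
        Finset.sum_add_distrib]
      ring
    · simp [hk, ih _ _ hν']

theorem eq_zero_of_modcomp_eq_zero {c : Series m} {d : Fin m → Series m}
    (h : modcomp m c d = 0) : c = 0 := by
  funext ν
  induction ν generalizing c with
  | nil => rw [← modcomp_apply_nil c d, h]
  | cons k ν ih =>
    have hs (i : Fin (m + 1)) (hi : i ≠ 0) : modcomp m (leftShift i c) d = 0 := by
      have hl := leftShift_modcomp i c d
      rw [h, if_neg hi, add_zero] at hl
      exact hl.symm
    refine ih (c := leftShift k c) ?_
    by_cases hk : k = 0
    · have hl := leftShift_modcomp k c d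
      have hsum : ∑ i, sh m (dsel m d i) (modcomp m (leftShift i c) d) = 0 := by
        refine Finset.sum_eq_zero fun i _ => ?_
        by_cases hi : i = 0
        · simp [dsel, hi, zero_sh]
        · rw [hs i hi, sh_zero]
      rw [h, if_pos hk, hsum, add_zero] at hl
      exact hl.symm
    · exact hs k hk

/-- Every right inverse for the output-feedback group law is also
a left inverse: if `c⁻¹ = (−c) ∘̃ c⁻¹` then `c = (−c⁻¹) ∘̃ c`. -/
theorem right_inverse_is_left_inverse (m : ℕ) (c ci : Fin m → Series m)
    (h : ci = modcompV m (-c) ci) : c = modcompV m (-ci) c := by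
  have hinv : modcompV m c ci + ci = 0 := by
    conv_lhs => rw [add_comm]; lhs; rw [h]
    funext j
    simp [modcompV, modcomp_neg]
  have hzero (j : Fin m) : c j + modcomp m (ci j) c = 0 := by
    refine eq_zero_of_modcomp_eq_zero (d := ci) ?_
    rw [modcomp_add, modcomp_modcomp, hinv, modcomp_zero]
    exact congrFun hinv j
  funext j
  simpa [modcompV, modcomp_neg] using eq_neg_of_add_eq_zero_left (hzero j)

end

end FliessStmt
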